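/- Let G be a strongly connected simple directed graph on n > 1 vertices, let w ∈ Sp(V), and let 𝒢_1,…,𝒢_p be the principal subsets of the set 𝒢 of cycles of G. Then 𝔸_G(w) = ∪_{i=1}^p Co(𝒢_i). -/

import Mathlib

open Matrix Finset
open scoped Classical

noncomputable section

/-- `A` is an infinitesimal stochastic matrix (ISM): all off-diagonal entries are
nonnegative and every row sums to zero. -/
def IsISM {n : ℕ} (A : Matrix (Fin n) (Fin n) ℝ) : Prop :=
  (∀ i j, i ≠ j → 0 ≤ A i j) ∧ ∀ i, ∑ j, A i j = 0

/-- `A` has the zero pattern prescribed by the digraph with edge relation `E`: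
`A i j = 0` whenever `i ≠ j` and `i → j` is not an edge. -/
def InPattern {n : ℕ} (E : Fin n → Fin n → Prop) (A : Matrix (Fin n) (Fin n) ℝ) : Prop :=
  ∀ i j, i ≠ j → ¬ E i j → A i j = 0

/-- `r` is a root of the digraph `E`: every vertex has a directed path to `r`. -/
def IsRootOf {n : ℕ} (E : Fin n → Fin n → Prop) (r : Fin n) : Prop :=
  ∀ i, Relation.ReflTransGen E i r

/-- The digraph `E` is rooted. -/
def Rooted {n : ℕ} (E : Fin n → Fin n → Prop) : Prop :=
  ∃ r, IsRootOf E r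

/-- `w` lies in the standard simplex `Sp[V]`. -/
def MemSimplex {n : ℕ} (w : Fin n → ℝ) : Prop :=
  (∀ i, 0 ≤ w i) ∧ ∑ i, w i = 1

/-- `0` is a simple eigenvalue of `A`: it is a root of multiplicity exactly one of
the characteristic polynomial of `A`. -/
def SimpleZeroEig {n : ℕ} (A : Matrix (Fin n) (Fin n) ℝ) : Prop :=
  Polynomial.rootMultiplicity 0 (Matrix.charpoly A) = 1

/-- `A ∈ 𝔸_G(w)`: the set of `w`-feasible dynamics. -/
def Feasible {n : ℕ} (E : Fin n → Fin n → Prop) (w : Fin n → ℝ)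
    (A : Matrix (Fin n) (Fin n) ℝ) : Prop :=
  IsISM A ∧ InPattern E A ∧ SimpleZeroEig A ∧ Aᵀ *ᵥ w = 0

/-- `S` is a relevant subset of the digraph `E`: it consists of roots and the induced
subgraph on `S` is strongly connected (paths staying inside `S`). -/
def RelevantSubset {n : ℕ} (E : Fin n → Fin n → Prop) (S : Set (Fin n)) : Prop :=
  (∀ i ∈ S, IsRootOf E i) ∧
    ∀ i ∈ S, ∀ j ∈ S, Relation.ReflTransGen (fun a b => E a b ∧ a ∈ S ∧ b ∈ S) i j

/-- `c` is (the edge relation of) a cycle of the digraph `E`: there are distinct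
vertices `v 0, …, v (m+1)` (hence at least two of them), each edge `v t → v (t+1)`
(indices cyclic) is an edge of `E`, and the edges of `c` are exactly these edges. -/
def IsCycleOf {n : ℕ} (E : Fin n → Fin n → Prop) (c : Fin n → Fin n → Prop) : Prop :=
  ∃ (m : ℕ) (v : Fin (m + 2) → Fin n), Function.Injective v ∧
    (∀ t, E (v t) (v (t + 1))) ∧
    ∀ i j, c i j ↔ ∃ t, v t = i ∧ v (t + 1) = j

/-- The ISM associated with a cycle `c` and the weight vector `w`: off-diagonal
entries are `1 / w j` on the edges of the cycle and `0` otherwise, and the diagonal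
entries are chosen so that every row sums to zero. -/
noncomputable def cycleISM {n : ℕ} (w : Fin n → ℝ) (c : Fin n → Fin n → Prop) :
    Matrix (Fin n) (Fin n) ℝ :=
  Matrix.of fun i j =>
    if i = j then -(∑ l ∈ Finset.univ.erase i, if c i l then (w i)⁻¹ else 0)
    else if c i j then (w i)⁻¹ else 0

/-- Given an enumeration `Gc` of the cycles of a digraph on `Fin n`, a set `S` of
indices of cycles is principal if the digraph whose edge set is the union of the
edge sets of the chosen cycles is strongly connected. -/
def PrincipalSubset {n k : ℕ} (Gc : Fin k → Fin n → Fin n → Prop) (S : Finset (Fin k)) : Prop :=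
  ∀ i j : Fin n, Relation.ReflTransGen (fun a b => ∃ s ∈ S, Gc s a b) i j

/-- `Co(𝒢')`: the set of strictly positive linear combinations of the matrices
`C s`, `s ∈ S`. -/
def coOpen {n k : ℕ} (C : Fin k → Matrix (Fin n) (Fin n) ℝ) (S : Finset (Fin k)) :
    Set (Matrix (Fin n) (Fin n) ℝ) :=
  {A | ∃ α : Fin k → ℝ, (∀ s ∈ S, 0 < α s) ∧ A = ∑ s ∈ S, α s • C s}

lemma sum_mul_mulVec_eq_zero {n : ℕ} {A : Matrix (Fin n) (Fin n) ℝ} {w : Fin n → ℝ}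
    (hA : Aᵀ *ᵥ w = 0) (x : Fin n → ℝ) : ∑ i, w i * (A *ᵥ x) i = 0 := by
  have h : w ⬝ᵥ (A *ᵥ x) = 0 := by
    rw [Matrix.dotProduct_mulVec, ← Matrix.mulVec_transpose, hA, zero_dotProduct]
  exact h

lemma mem_maxGenEigenspace_toLin'_zero {n : ℕ} (A : Matrix (Fin n) (Fin n) ℝ) (x : Fin n → ℝ) :
    x ∈ Module.End.maxGenEigenspace (Matrix.toLin' A) 0 ↔
      ∃ m : ℕ, (Matrix.toLin' A ^ m) x = 0 := by
  simp [Module.End.mem_maxGenEigenspace]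

lemma simpleZeroEig_iff_finrank {n : ℕ} (A : Matrix (Fin n) (Fin n) ℝ) :
    SimpleZeroEig A ↔
      Module.finrank ℝ (Module.End.maxGenEigenspace (Matrix.toLin' A) 0) = 1 := by
  rw [LinearMap.finrank_maxGenEigenspace_eq, Matrix.charpoly_toLin', SimpleZeroEig]

lemma IsISM.mulVec_one {n : ℕ} {A : Matrix (Fin n) (Fin n) ℝ} (hA : IsISM A) :
    A *ᵥ (fun _ => 1) = 0 := by
  ext i
  simpa [Matrix.mulVec, dotProduct] using hA.2 i

lemma IsISM.diag_nonpos {n : ℕ} {A : Matrix (Fin n) (Fin n) ℝ} (hA : IsISM A) (i : Fin n) :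
    A i i ≤ 0 := by
  have h := hA.2 i
  rw [← Finset.add_sum_erase _ _ (Finset.mem_univ i)] at h
  have : 0 ≤ ∑ j ∈ Finset.univ.erase i, A i j :=
    Finset.sum_nonneg fun j hj => hA.1 i j (Finset.ne_of_mem_erase hj).symm
  linarith

/-- Two matrices with vanishing row sums which agree off the diagonal are equal. -/
lemma eq_of_offDiag_eq {n : ℕ} {A B : Matrix (Fin n) (Fin n) ℝ}
    (hA : ∀ i, ∑ j, A i j = 0) (hB : ∀ i, ∑ j, B i j = 0)
    (h : ∀ i j, i ≠ j → A i j = B i j) : A = B := by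
  ext i j
  rcases eq_or_ne i j with rfl | hij
  · have h1 := hA i
    have h2 := hB i
    rw [← Finset.add_sum_erase _ _ (Finset.mem_univ i)] at h1 h2
    have h3 : ∑ j ∈ Finset.univ.erase i, A i j = ∑ j ∈ Finset.univ.erase i, B i j :=
      Finset.sum_congr rfl fun j hj => h i j (Finset.ne_of_mem_erase hj).symm
    linarith
  · exact h i j hij

/-- An ISM with a positive invariant vector and simple eigenvalue `0` is irreducible. -/
lemma IsISM.reflTransGen_of_simpleZeroEig {n : ℕ} {A : Matrix (Fin n) (Fin n) ℝ}
    {w : Fin n → ℝ} (hA : IsISM A) (hw : ∀ i, 0 < w i) (hwA : Aᵀ *ᵥ w = 0)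
    (hs : SimpleZeroEig A) (i j : Fin n) :
    Relation.ReflTransGen (fun a b => 0 < A a b) i j := by
  set P : Fin n → Prop := Relation.ReflTransGen (fun a b => 0 < A a b) i with hP
  set x : Fin n → ℝ := fun b => if P b then 1 else 0 with hx
  have hin : ∀ a, P a → (A *ᵥ x) a = 0 := by
    intro a ha
    rw [← hA.2 a]
    change ∑ b, A a b * x b = ∑ b, A a b
    refine Finset.sum_congr rfl fun b _ => ?_
    by_cases hb : P b
    · simp [hx, hb]
    · have hab : a ≠ b := by
        rintro rfl
        exact hb ha
      have : ¬ 0 < A a b := fun h => hb (ha.tail h)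
      have h0 : A a b = 0 := le_antisymm (not_lt.1 this) (hA.1 a b hab)
      simp [h0]
  have hnn : ∀ a, 0 ≤ (A *ᵥ x) a := by
    intro a
    by_cases ha : P a
    · exact (hin a ha).ge
    · change 0 ≤ ∑ b, A a b * x b
      refine Finset.sum_nonneg fun b _ => ?_
      by_cases hb : P b
      · have hab : a ≠ b := by
          rintro rfl
          exact ha hb
        simpa [hx, hb] using hA.1 a b hab
      · simp [hx, hb]
  have hker : A *ᵥ x = 0 := by
    have h := (Finset.sum_eq_zero_iff_of_nonneg
      (fun a _ => mul_nonneg (hw a).le (hnn a))).1 (sum_mul_mulVec_eq_zero hwA x)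
    ext a
    exact (mul_eq_zero.1 (h a (Finset.mem_univ a))).resolve_left (hw a).ne'
  obtain ⟨v, -, hv⟩ := finrank_eq_one_iff'.1 ((simpleZeroEig_iff_finrank A).1 hs)
  obtain ⟨c, hc⟩ := hv ⟨x, (mem_maxGenEigenspace_toLin'_zero A x).2 ⟨1, by simpa using hker⟩⟩
  obtain ⟨d, hd⟩ := hv ⟨fun _ => 1,
    (mem_maxGenEigenspace_toLin'_zero A _).2 ⟨1, by simpa using hA.mulVec_one⟩⟩
  have hc' : ∀ a, c * (v : Fin n → ℝ) a = x a := fun a => congrFun (congrArg Subtype.val hc) a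
  have hd' : ∀ a, d * (v : Fin n → ℝ) a = 1 := fun a => congrFun (congrArg Subtype.val hd) a
  have hxi : x i = 1 := by simp [hx, hP, Relation.ReflTransGen.refl]
  have hvi : (v : Fin n → ℝ) i ≠ 0 := fun h => by simpa [h] using hd' i
  have hcd : c = d := mul_right_cancel₀ hvi (by rw [hc', hd', hxi])
  have hxj : x j = 1 := by rw [← hc', hcd, hd']
  by_contra hj
  have : ¬ P j := hj
  simp [hx, this] at hxj

/-- Maximum principle: the kernel of an irreducible ISM consists of constant vectors. -/
lemma IsISM.exists_eq_const_of_mulVec_eq_zero {n : ℕ} {A : Matrix (Fin n) (Fin n) ℝ}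
    (hn : 0 < n) (hA : IsISM A)
    (hconn : ∀ i j, Relation.ReflTransGen (fun a b => 0 < A a b) i j)
    {x : Fin n → ℝ} (hx : A *ᵥ x = 0) : ∃ c, x = fun _ => c := by
  have : Nonempty (Fin n) := ⟨⟨0, hn⟩⟩
  obtain ⟨i, hi⟩ := Finite.exists_max x
  refine ⟨x i, funext fun j => ?_⟩
  induction hconn i j with
  | refl => rfl
  | @tail b c _ hbc ih =>
    have hsum : ∑ j, A b j * (x b - x j) = 0 := by
      have h : ∑ j, A b j * x j = 0 := congrFun hx b
      simp only [mul_sub, Finset.sum_sub_distrib, ← Finset.sum_mul, hA.2 b, h]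
      simp
    have hnn : ∀ j ∈ Finset.univ, 0 ≤ A b j * (x b - x j) := by
      intro j _
      rcases eq_or_ne b j with rfl | hbj
      · simp
      · exact mul_nonneg (hA.1 b j hbj) (by rw [ih]; linarith [hi j])
    have h := (Finset.sum_eq_zero_iff_of_nonneg hnn).1 hsum c (Finset.mem_univ c)
    have := (mul_eq_zero.1 h).resolve_left hbc.ne'
    linarith

/-- An irreducible ISM with an invariant vector of total mass one has simple eigenvalue `0`. -/
lemma IsISM.simpleZeroEig_of_reflTransGen {n : ℕ} {A : Matrix (Fin n) (Fin n) ℝ}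
    {w : Fin n → ℝ} (hn : 0 < n) (hA : IsISM A) (hw1 : ∑ i, w i = 1) (hwA : Aᵀ *ᵥ w = 0)
    (hconn : ∀ i j, Relation.ReflTransGen (fun a b => 0 < A a b) i j) :
    SimpleZeroEig A := by
  have key : ∀ (m : ℕ) (x : Fin n → ℝ), (Matrix.toLin' A ^ m) x = 0 → ∃ c : ℝ, x = fun _ => c := by
    intro m
    induction m with
    | zero =>
      intro x hx
      exact ⟨0, hx⟩
    | succ m ih =>
      intro x hx
      rw [pow_succ, Module.End.mul_apply, Matrix.toLin'_apply] at hx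
      obtain ⟨c, hc⟩ := ih _ hx
      have h := sum_mul_mulVec_eq_zero hwA x
      rw [hc, ← Finset.sum_mul, hw1, one_mul] at h
      exact hA.exists_eq_const_of_mulVec_eq_zero hn hconn (by rw [hc, h]; rfl)
  rw [simpleZeroEig_iff_finrank, finrank_eq_one_iff']
  refine ⟨⟨fun _ => 1, (mem_maxGenEigenspace_toLin'_zero A _).2
    ⟨1, by simpa using hA.mulVec_one⟩⟩, fun h => ?_, ?_⟩
  · have := congrFun (congrArg Subtype.val h) ⟨0, hn⟩
    simp at this
  · rintro ⟨x, hx⟩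
    obtain ⟨m, hm⟩ := (mem_maxGenEigenspace_toLin'_zero A x).1 hx
    obtain ⟨c, rfl⟩ := key m x hm
    exact ⟨c, by ext; simp⟩

/-- The indicator of the edges of a digraph, as a real matrix. -/
def edgeIndicator {n : ℕ} (c : Fin n → Fin n → Prop) (i j : Fin n) : ℝ :=
  if c i j then 1 else 0

/-- The flow `F` is conserved at every vertex. -/
def IsCirculation {n : ℕ} (F : Fin n → Fin n → ℝ) : Prop :=
  ∀ i, ∑ j, F i j = ∑ j, F j i

lemma IsCycleOf.le {n : ℕ} {E c : Fin n → Fin n → Prop} (h : IsCycleOf E c) {i j : Fin n}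
    (hij : c i j) : E i j := by
  obtain ⟨m, v, -, hE, hc⟩ := h
  obtain ⟨t, rfl, rfl⟩ := (hc i j).1 hij
  exact hE t

lemma IsCycleOf.exists_edge {n : ℕ} {E c : Fin n → Fin n → Prop} (h : IsCycleOf E c) :
    ∃ i j, c i j := by
  obtain ⟨m, v, -, -, hc⟩ := h
  exact ⟨v 0, v (0 + 1), (hc _ _).2 ⟨0, rfl, rfl⟩⟩

lemma IsCycleOf.mono {n : ℕ} {E E' c : Fin n → Fin n → Prop} (h : IsCycleOf E c)
    (hE : ∀ i j, E i j → E' i j) : IsCycleOf E' c := by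
  obtain ⟨m, v, hv, h1, hc⟩ := h
  exact ⟨m, v, hv, fun t => hE _ _ (h1 t), hc⟩

lemma IsCycleOf.isCirculation {n : ℕ} {E c : Fin n → Fin n → Prop} (h : IsCycleOf E c) :
    IsCirculation (edgeIndicator c) := by
  obtain ⟨m, v, hv, -, hc⟩ := h
  have hind : ∀ i j, edgeIndicator c i j =
      ∑ t, (if v t = i then if v (t + 1) = j then (1 : ℝ) else 0 else 0) := by
    intro i j
    by_cases hij : c i j
    · obtain ⟨t, ht, ht'⟩ := (hc i j).1 hij
      rw [Finset.sum_eq_single t]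
      · simp [edgeIndicator, hij, ht, ht']
      · intro s _ hs
        rw [if_neg]
        rintro rfl
        exact hs (hv ht.symm)
      · simp
    · rw [edgeIndicator, if_neg hij, Finset.sum_eq_zero]
      intro t _
      by_cases h1 : v t = i
      · by_cases h2 : v (t + 1) = j
        · exact absurd ((hc i j).2 ⟨t, h1, h2⟩) hij
        · simp [h2]
      · simp [h1]
  intro i
  simp only [hind]
  rw [Finset.sum_comm, Finset.sum_comm (s := Finset.univ (α := Fin n))]
  have h1 : ∀ t, ∑ j, (if v t = i then if v (t + 1) = j then (1 : ℝ) else 0 else 0) =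
      if v t = i then 1 else 0 := by
    intro t
    split_ifs <;> simp
  have h2 : ∀ t, ∑ j, (if v t = j then if v (t + 1) = i then (1 : ℝ) else 0 else 0) =
      if v (t + 1) = i then 1 else 0 := by
    intro t
    simp
  simp only [h1, h2]
  exact (Equiv.sum_comp (Equiv.addRight (1 : Fin (m + 2)))
    (fun t => if v t = i then (1 : ℝ) else 0)).symm

/-- A self-map of a finite vertex set whose orbit from `x` runs along edges of a loopless
digraph traces a cycle of that digraph. -/
lemma exists_isCycleOf_of_iterate {n : ℕ} {E : Fin n → Fin n → Prop} (hE : ∀ i, ¬ E i i)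
    (f : Fin n → Fin n) (x : Fin n) (hf : ∀ m, E (f^[m] x) (f^[m + 1] x)) :
    ∃ c, IsCycleOf E c := by
  obtain ⟨a, b, hab, hfab⟩ := Finite.exists_ne_map_eq_of_infinite (fun m : ℕ => f^[m] x)
  wlog hlt : a < b generalizing a b
  · exact this b a hab.symm hfab.symm (lt_of_le_of_ne (not_lt.1 hlt) hab.symm)
  set y := f^[a] x with hy
  have hper : Function.IsPeriodicPt f (b - a) y := by
    rw [Function.IsPeriodicPt, Function.IsFixedPt, hy, ← Function.iterate_add_apply,
      Nat.sub_add_cancel hlt.le]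
    exact hfab.symm
  have hEy : ∀ m, E (f^[m] y) (f^[m + 1] y) := by
    intro m
    have := hf (m + a)
    rw [hy, ← Function.iterate_add_apply, ← Function.iterate_add_apply]
    convert this using 2
    ring
  have hpos := hper.minimalPeriod_pos (Nat.sub_pos_of_lt hlt)
  have hne1 : Function.minimalPeriod f y ≠ 1 := by
    intro h
    have h1 : f y = y := Function.minimalPeriod_eq_one_iff_isFixedPt.1 h
    have h2 := hEy 0
    simp only [zero_add, Function.iterate_one, Function.iterate_zero, id, h1] at h2
    exact hE y h2
  obtain ⟨m, hm⟩ : ∃ m, Function.minimalPeriod f y = m + 2 :=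
    ⟨Function.minimalPeriod f y - 2, by omega⟩
  have hstep : ∀ t : Fin (m + 2), f^[((t + 1 : Fin (m + 2)) : ℕ)] y = f^[(t : ℕ) + 1] y := by
    intro t
    have h := Function.iterate_mod_minimalPeriod_eq (f := f) (x := y) (n := (t : ℕ) + 1)
    rw [hm] at h
    rw [← h, Fin.val_add]
    simp
  refine ⟨fun i j => ∃ t : Fin (m + 2), f^[(t : ℕ)] y = i ∧
    f^[((t + 1 : Fin (m + 2)) : ℕ)] y = j, m, fun t => f^[(t : ℕ)] y, ?_, ?_, ?_⟩
  · intro s t hst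
    exact Fin.ext (Function.iterate_injOn_Iio_minimalPeriod (f := f) (x := y)
      (by simp [hm]) (by simp [hm]) hst)
  · intro t
    simp only [hstep]
    exact hEy t
  · intro i j
    rfl

/-- The support of a nonzero nonnegative loopless circulation contains a cycle. -/
lemma IsCirculation.exists_isCycleOf {n : ℕ} {F : Fin n → Fin n → ℝ} (hF : IsCirculation F)
    (hnn : ∀ i j, 0 ≤ F i j) (hloop : ∀ i, F i i = 0) {a b : Fin n} (hab : 0 < F a b) :
    ∃ c, IsCycleOf (fun i j => 0 < F i j) c := by
  have hnext : ∀ i j, 0 < F i j → ∃ l, 0 < F j l := by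
    intro i j hij
    have h1 : 0 < ∑ l, F l j :=
      Finset.sum_pos' (fun l _ => hnn l j) ⟨i, Finset.mem_univ i, hij⟩
    rw [← hF j] at h1
    obtain ⟨l, -, hl⟩ := Finset.exists_lt_of_sum_lt
      (s := Finset.univ) (f := fun _ => (0 : ℝ)) (g := fun l => F j l) (by simpa using h1)
    exact ⟨l, hl⟩
  let f : Fin n → Fin n := fun j => if h : ∃ l, 0 < F j l then h.choose else j
  have hf : ∀ j, (∃ l, 0 < F j l) → 0 < F j (f j) := by
    intro j h
    simp only [f, dif_pos h]
    exact h.choose_spec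
  have hpos : ∀ m, ∃ l, 0 < F (f^[m] a) l := by
    intro m
    induction m with
    | zero => exact ⟨b, hab⟩
    | succ m ih =>
      rw [Function.iterate_succ_apply']
      exact hnext _ _ (hf _ ih)
  refine exists_isCycleOf_of_iterate (fun i => by simp [hloop i]) f a fun m => ?_
  rw [Function.iterate_succ_apply']
  exact hf _ (hpos m)

/-- Every nonnegative circulation supported on a loopless digraph is a nonnegative
combination of cycles of that digraph. -/
lemma IsCirculation.exists_decomposition {n k : ℕ} {E : Fin n → Fin n → Prop}
    (hsimple : ∀ i, ¬ E i i) {Gc : Fin k → Fin n → Fin n → Prop}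
    (hall : ∀ c, IsCycleOf E c → ∃ t, Gc t = c)
    {F : Fin n → Fin n → ℝ} (hF : IsCirculation F) (hnn : ∀ i j, 0 ≤ F i j)
    (hsupp : ∀ i j, 0 < F i j → E i j) :
    ∃ α : Fin k → ℝ, (∀ t, 0 ≤ α t) ∧
      ∀ i j, F i j = ∑ t, α t * edgeIndicator (Gc t) i j := by
  induction hN : (Finset.univ.filter fun p : Fin n × Fin n => 0 < F p.1 p.2).card
    using Nat.strong_induction_on generalizing F with
  | _ N ih =>
  by_cases hzero : ∀ i j, F i j = 0
  · exact ⟨fun _ => 0, fun _ => le_rfl, fun i j => by simp [hzero i j]⟩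
  push Not at hzero
  obtain ⟨a, b, hab⟩ := hzero
  have hloop : ∀ i, F i i = 0 := fun i =>
    le_antisymm (not_lt.1 fun h => hsimple i (hsupp i i h)) (hnn i i)
  obtain ⟨c, hc⟩ := hF.exists_isCycleOf hnn hloop (lt_of_le_of_ne (hnn a b) hab.symm)
  obtain ⟨t, ht⟩ := hall c (hc.mono hsupp)
  obtain ⟨u₀, v₀, huv₀⟩ := hc.exists_edge
  obtain ⟨⟨u, v⟩, huv, hmin⟩ := Finset.exists_min_image
    (Finset.univ.filter fun p : Fin n × Fin n => c p.1 p.2) (fun p => F p.1 p.2)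
    ⟨(u₀, v₀), by simpa using huv₀⟩
  simp only [Finset.mem_filter, Finset.mem_univ, true_and, Prod.forall] at huv hmin
  have hpos : 0 < F u v := hc.le huv
  let F' : Fin n → Fin n → ℝ := fun i j => F i j - F u v * edgeIndicator c i j
  have hle : ∀ i j, F' i j ≤ F i j := by
    intro i j
    simp only [F', edgeIndicator]
    split_ifs <;> linarith
  have hF' : IsCirculation F' := by
    intro i
    simp only [F', Finset.sum_sub_distrib, ← Finset.mul_sum, hF i, hc.isCirculation i]
  have hnn' : ∀ i j, 0 ≤ F' i j := by
    intro i j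
    simp only [F', edgeIndicator]
    split_ifs with h
    · linarith [hmin i j h]
    · linarith [hnn i j]
  have hcard : (Finset.univ.filter fun p : Fin n × Fin n => 0 < F' p.1 p.2).card < N := by
    rw [← hN]
    refine Finset.card_lt_card (Finset.ssubset_iff_of_subset ?_ |>.2 ⟨(u, v), ?_, ?_⟩)
    · intro p hp
      simp only [Finset.mem_filter, Finset.mem_univ, true_and] at hp ⊢
      exact hp.trans_le (hle _ _)
    · simpa using hpos
    · simp [F', edgeIndicator, huv]
  obtain ⟨α, hα, hdec⟩ := ih _ hcard hF' hnn'
    (fun i j h => hsupp i j (h.trans_le (hle i j))) rfl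
  refine ⟨fun s => α s + if s = t then F u v else 0, fun s => ?_, fun i j => ?_⟩
  · have := hα s
    dsimp only
    split_ifs <;> linarith
  · have h := hdec i j
    simp only [add_mul, Finset.sum_add_distrib, ← h, ite_mul, zero_mul, Finset.sum_ite_eq',
      Finset.mem_univ, if_true, ht, F']
    ring

lemma cycleISM_apply_of_ne {n : ℕ} (w : Fin n → ℝ) (c : Fin n → Fin n → Prop) {i j : Fin n}
    (hij : i ≠ j) : cycleISM w c i j = (w i)⁻¹ * edgeIndicator c i j := by
  simp [cycleISM, edgeIndicator, hij]

lemma cycleISM_row_sum {n : ℕ} (w : Fin n → ℝ) (c : Fin n → Fin n → Prop) (i : Fin n) :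
    ∑ j, cycleISM w c i j = 0 := by
  rw [← Finset.add_sum_erase _ _ (Finset.mem_univ i)]
  have h : ∑ j ∈ Finset.univ.erase i, cycleISM w c i j =
      ∑ j ∈ Finset.univ.erase i, if c i j then (w i)⁻¹ else 0 := by
    refine Finset.sum_congr rfl fun j hj => ?_
    simp [cycleISM, (Finset.ne_of_mem_erase hj).symm]
  rw [h]
  simp [cycleISM]

/-- For a matrix with zero row sums, invariance of `w` says that the flow `w i * A i j`
off the diagonal is conserved. -/
lemma transpose_mulVec_eq_zero_iff {n : ℕ} {A : Matrix (Fin n) (Fin n) ℝ} {w : Fin n → ℝ}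
    (hA : ∀ i, ∑ j, A i j = 0) :
    Aᵀ *ᵥ w = 0 ↔ IsCirculation fun i j => if i = j then 0 else w i * A i j := by
  have hout : ∀ i, ∑ j, (if i = j then 0 else w i * A i j) = - (w i * A i i) := by
    intro i
    have h : ∑ j, w i * A i j = 0 := by rw [← Finset.mul_sum, hA i, mul_zero]
    rw [← Finset.add_sum_erase _ _ (Finset.mem_univ i)] at h ⊢
    have h' : ∑ j ∈ Finset.univ.erase i, (if i = j then 0 else w i * A i j) =
        ∑ j ∈ Finset.univ.erase i, w i * A i j :=
      Finset.sum_congr rfl fun j hj => if_neg (Finset.ne_of_mem_erase hj).symm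
    rw [h', if_pos rfl]
    linarith
  have hin : ∀ i, ∑ j, (if j = i then 0 else w j * A j i) =
      (Aᵀ *ᵥ w) i - w i * A i i := by
    intro i
    have h : (Aᵀ *ᵥ w) i = ∑ j, w j * A j i := by
      simp [Matrix.mulVec, dotProduct, mul_comm]
    rw [h, ← Finset.add_sum_erase _ _ (Finset.mem_univ i),
      ← Finset.add_sum_erase _ (fun j => w j * A j i) (Finset.mem_univ i)]
    have h' : ∑ j ∈ Finset.univ.erase i, (if j = i then 0 else w j * A j i) =
        ∑ j ∈ Finset.univ.erase i, w j * A j i :=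
      Finset.sum_congr rfl fun j hj => if_neg (Finset.ne_of_mem_erase hj)
    rw [h', if_pos rfl]
    ring
  simp only [IsCirculation, hout, hin, funext_iff, Pi.zero_apply]
  exact forall_congr' fun i => ⟨fun h => by rw [h]; ring, fun h => by linarith⟩

lemma sum_smul_cycleISM_row_sum {n k : ℕ} (w : Fin n → ℝ) (Gc : Fin k → Fin n → Fin n → Prop)
    (S : Finset (Fin k)) (α : Fin k → ℝ) (i : Fin n) :
    ∑ j, (∑ s ∈ S, α s • cycleISM w (Gc s)) i j = 0 := by
  simp only [Matrix.sum_apply, Matrix.smul_apply, smul_eq_mul]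
  rw [Finset.sum_comm]
  simp [← Finset.mul_sum, cycleISM_row_sum]

lemma sum_smul_cycleISM_apply_of_ne {n k : ℕ} (w : Fin n → ℝ)
    (Gc : Fin k → Fin n → Fin n → Prop) (S : Finset (Fin k)) (α : Fin k → ℝ) {i j : Fin n}
    (hij : i ≠ j) :
    (∑ s ∈ S, α s • cycleISM w (Gc s)) i j =
      (w i)⁻¹ * ∑ s ∈ S, α s * edgeIndicator (Gc s) i j := by
  simp only [Matrix.sum_apply, Matrix.smul_apply, smul_eq_mul, cycleISM_apply_of_ne w _ hij,
    Finset.mul_sum]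
  exact Finset.sum_congr rfl fun s _ => by ring

lemma IsCirculation.sum_smul {n k : ℕ} {F : Fin k → Fin n → Fin n → ℝ} (S : Finset (Fin k))
    (α : Fin k → ℝ) (hF : ∀ s, IsCirculation (F s)) :
    IsCirculation fun i j => ∑ s ∈ S, α s * F s i j := by
  intro i
  rw [Finset.sum_comm, Finset.sum_comm (s := Finset.univ (α := Fin n))]
  simp only [← Finset.mul_sum, hF _ i]

lemma edgeIndicator_nonneg {n : ℕ} (c : Fin n → Fin n → Prop) (i j : Fin n) :
    0 ≤ edgeIndicator c i j := by
  unfold edgeIndicator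
  split_ifs <;> norm_num

/-- Proposition 3: for `G` strongly connected on `n > 1` vertices and `w` in the
interior of the simplex, `𝔸_G(w)` is the union of the sets `Co(𝒢_i)` over all
principal subsets `𝒢_i` of the set of cycles of `G`. -/
theorem feasible_eq_union_principal
    (n k : ℕ) (hn : 1 < n)
    (E : Fin n → Fin n → Prop) (hsimple : ∀ i, ¬ E i i)
    (hsc : ∀ i j : Fin n, Relation.ReflTransGen E i j)
    (w : Fin n → ℝ) (hw : ∀ i, 0 < w i) (hw1 : ∑ i, w i = 1)
    (Gc : Fin k → Fin n → Fin n → Prop)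
    (hcyc : ∀ t, IsCycleOf E (Gc t)) (hinj : Function.Injective Gc)
    (hall : ∀ c, IsCycleOf E c → ∃ t, Gc t = c) :
    {A : Matrix (Fin n) (Fin n) ℝ | Feasible E w A} =
      ⋃ (S : Finset (Fin k)) (_ : PrincipalSubset Gc S),
        coOpen (fun t => cycleISM w (Gc t)) S := by
  have hGc : ∀ t i, ¬ Gc t i i := fun t i h => hsimple i ((hcyc t).le h)
  ext A
  simp only [Set.mem_ofPred_eq, Set.mem_iUnion, exists_prop]
  constructor
  · rintro ⟨hISM, hpat, hs, hwA⟩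
    have hF := (transpose_mulVec_eq_zero_iff hISM.2).1 hwA
    obtain ⟨α, hα, hdec⟩ := hF.exists_decomposition hsimple hall
      (fun i j => by
        split_ifs with h
        · exact le_rfl
        · exact mul_nonneg (hw i).le (hISM.1 i j h))
      (fun i j hij => by
        by_contra hE
        split_ifs at hij with h
        · exact hij.false
        · simp [hpat i j h hE] at hij)
    have hdecS : ∀ i j, ∑ t, α t * edgeIndicator (Gc t) i j =
        ∑ t ∈ Finset.univ.filter (fun t => 0 < α t), α t * edgeIndicator (Gc t) i j := by
      intro i j
      refine (Finset.sum_subset (Finset.filter_subset _ _) fun t _ ht => ?_).symm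
      have h0 : α t = 0 := le_antisymm (by simpa using ht) (hα t)
      simp [h0]
    refine ⟨Finset.univ.filter fun t => 0 < α t, fun i j => ?_, α, by simp, ?_⟩
    · refine Relation.ReflTransGen.mono (fun a b hab => ?_) i j
        (hISM.reflTransGen_of_simpleZeroEig hw hwA hs i j)
      have hne : a ≠ b := by
        rintro rfl
        exact (hISM.diag_nonpos a).not_gt hab
      have h := hdec a b
      rw [if_neg hne, hdecS] at h
      by_contra hcon
      push Not at hcon
      rw [Finset.sum_eq_zero] at h
      · exact (mul_pos (hw a) hab).ne' h
      · intro s hs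
        simp [edgeIndicator, hcon s hs]
    · refine eq_of_offDiag_eq hISM.2 (sum_smul_cycleISM_row_sum w Gc _ α) fun i j hij => ?_
      have h := hdec i j
      rw [if_neg hij, hdecS] at h
      rw [sum_smul_cycleISM_apply_of_ne w Gc _ α hij, ← h, inv_mul_cancel_left₀ (hw i).ne']
  · rintro ⟨S, hS, α, hα, rfl⟩
    have hoff := fun i j (hij : i ≠ j) => sum_smul_cycleISM_apply_of_ne w Gc S α hij
    have hterm : ∀ i j, ∀ s ∈ S, 0 ≤ α s * edgeIndicator (Gc s) i j := fun i j s hs =>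
      mul_nonneg (hα s hs).le (edgeIndicator_nonneg _ _ _)
    have hISM : IsISM (∑ s ∈ S, α s • cycleISM w (Gc s)) := by
      refine ⟨fun i j hij => ?_, sum_smul_cycleISM_row_sum w Gc S α⟩
      rw [hoff i j hij]
      exact mul_nonneg (inv_nonneg.2 (hw i).le) (Finset.sum_nonneg (hterm i j))
    have hwA : (∑ s ∈ S, α s • cycleISM w (Gc s))ᵀ *ᵥ w = 0 := by
      rw [transpose_mulVec_eq_zero_iff hISM.2]
      convert IsCirculation.sum_smul S α fun s => (hcyc s).isCirculation using 3 with i j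
      split_ifs with hij
      · subst hij
        simp [edgeIndicator, hGc]
      · rw [hoff i j hij, mul_inv_cancel_left₀ (hw i).ne']
    refine ⟨hISM, fun i j hij hE => ?_,
      hISM.simpleZeroEig_of_reflTransGen (by omega) hw1 hwA fun i j => ?_, hwA⟩
    · rw [hoff i j hij, Finset.sum_eq_zero, mul_zero]
      intro s _
      have : ¬ Gc s i j := fun h => hE ((hcyc s).le h)
      simp [edgeIndicator, this]
    · refine Relation.ReflTransGen.mono (fun a b hab => ?_) i j (hS i j)
      obtain ⟨s, hs, hsab⟩ := hab
      have hne : a ≠ b := by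
        rintro rfl
        exact hGc s a hsab
      rw [hoff a b hne]
      refine mul_pos (inv_pos.2 (hw a)) (Finset.sum_pos' (hterm a b) ⟨s, hs, ?_⟩)
      simpa [edgeIndicator, hsab] using hα s hs
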